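/- Let χ : ℤ → ℤ be defined by χ(n) = 1 if n ≡ 1 or 11 (mod 12), χ(n) = −1 if n ≡ 5 or 7 (mod 12), and χ(n) = 0 otherwise, and let h : ℝ → ℂ be defined by h(x) = ∑_{n=1}^∞ χ(n) n^{−2} e(n²x/24). For every irrational number x₀ and every real α > 3/4, limsup_{x → x₀} |x − x₀|^{−α} · |Re h(x) − Re h(x₀)| = ∞, and likewise limsup_{x → x₀} |x − x₀|^{−α} · |Im h(x) − Im h(x₀)| = ∞. -/

import Mathlib

open Complex Filter Topology

/-- `e x = exp(2 π i x)` -/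
noncomputable def e (t : ℝ) : ℂ := Complex.exp (2 * Real.pi * Complex.I * t)

/-- The even primitive Dirichlet character modulo 12 (the Kronecker symbol `(12/·)`). -/
def χ (n : ℤ) : ℤ :=
  if n % 12 = 1 ∨ n % 12 = 11 then 1
  else if n % 12 = 5 ∨ n % 12 = 7 then -1
  else 0

/-- The (normalized) antiderivative of the boundary distribution of the Dedekind
eta function: `h(x) = ∑_{n ≥ 1} χ(n) n⁻² e(n²x/24)`.
(The `n = 0` term of the `tsum` vanishes, since `χ 0 = 0`.) -/
noncomputable def h (x : ℝ) : ℂ :=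
  ∑' n : ℕ, (χ (n : ℤ) : ℂ) / (n : ℂ) ^ 2 * e ((n : ℝ) ^ 2 * x / 24)

/-- The theta series `∑_{m ∈ ℤ} χ(m) exp(π i m² z / 12)`, which is twice the Dedekind eta
function. -/
noncomputable def etaTheta (z : ℂ) : ℂ :=
  ∑' m : ℤ, (χ m : ℂ) * cexp (Real.pi * I * (m : ℂ) ^ 2 * z / 12)

lemma χ_neg (m : ℤ) : χ (-m) = χ m := by
  unfold χ; grind

/-- A sum over an arithmetic progression is the sum of the function cut off to it. -/
lemma hasSum_residue_iff {f : ℤ → ℂ} {s : ℂ} (a : ℤ) :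
    HasSum (fun n : ℤ => f (12 * n + a)) s ↔
      HasSum (fun m : ℤ => if m % 12 = a % 12 then f m else 0) s := by
  have hinj : Function.Injective (fun n : ℤ => 12 * n + a) := fun x y hxy => by
    simp only at hxy; lia
  rw [← hinj.hasSum_iff (f := fun m : ℤ => if m % 12 = a % 12 then f m else 0)]
  · refine iff_of_eq (congrArg (HasSum · s _) (funext fun n => ?_))
    simp [Int.add_emod]
  · intro x hx
    rw [if_neg]
    intro h12
    exact hx ⟨(x - a) / 12, by simp only; lia⟩

/-- An even function summed against `χ` splits over the progressions `12 n - 1` and `12 n - 5`. -/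
lemma hasSum_χ_mul {f : ℤ → ℂ} (hf : ∀ m, f (-m) = f m) {s t : ℂ}
    (hs : HasSum (fun n : ℤ => f (12 * n - 1)) s) (ht : HasSum (fun n : ℤ => f (12 * n - 5)) t) :
    HasSum (fun m : ℤ => (χ m : ℂ) * f m) (2 * s - 2 * t) := by
  have aux : ∀ {a : ℤ} {s : ℂ}, HasSum (fun n : ℤ => f (12 * n - a)) s →
      HasSum (fun n : ℤ => f (12 * n + a)) s := fun {a s} hs => by
    rw [← (Equiv.neg ℤ).hasSum_iff]
    refine hs.congr_fun fun n => ?_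
    rw [← hf]; simp only [Function.comp, Equiv.neg_apply]; congr 1; ring
  have h1 := (hasSum_residue_iff 1).1 (aux hs)
  have h5 := (hasSum_residue_iff 5).1 (aux ht)
  have h11 := (hasSum_residue_iff (-1)).1 (by simpa only [sub_eq_add_neg] using hs)
  have h7 := (hasSum_residue_iff (-5)).1 (by simpa only [sub_eq_add_neg] using ht)
  have := (h1.add h11).sub (h5.add h7)
  rw [show 2 * s - 2 * t = s + s - (t + t) by ring]
  refine this.congr_fun fun m => ?_
  have h12 : 0 ≤ m % 12 ∧ m % 12 < 12 := ⟨by lia, by lia⟩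
  unfold χ
  generalize m % 12 = r at *
  obtain ⟨hr0, hr1⟩ := h12
  interval_cases r <;> simp

lemma sin_int_mul_pi_div_two (j : ℤ) :
    Real.sin ((2 * j : ℤ) * (Real.pi / 2)) = 0 ∧ Real.sin ((4 * j + 1 : ℤ) * (Real.pi / 2)) = 1 ∧
      Real.sin ((4 * j - 1 : ℤ) * (Real.pi / 2)) = -1 := by
  refine ⟨?_, ?_, ?_⟩
  · rw [← Real.sin_int_mul_pi j]; congr 1; push_cast; ring
  · rw [← Real.sin_pi_div_two, ← Real.sin_add_int_mul_two_pi (Real.pi / 2) j]; congr 1; push_cast; ring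
  · rw [← Real.sin_pi_div_two, ← Real.sin_neg, ← Real.sin_add_int_mul_two_pi (-(Real.pi / 2)) j]
    congr 1; push_cast; ring

lemma sin_int_mul_pi_div_three (j : ℤ) :
    Real.sin ((3 * j : ℤ) * (Real.pi / 3)) = 0 ∧
      Real.sin ((6 * j + 1 : ℤ) * (Real.pi / 3)) = Real.sqrt 3 / 2 ∧
      Real.sin ((6 * j - 1 : ℤ) * (Real.pi / 3)) = -(Real.sqrt 3 / 2) := by
  refine ⟨?_, ?_, ?_⟩
  · rw [← Real.sin_int_mul_pi j]; congr 1; push_cast; ring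
  · rw [← Real.sin_pi_div_three, ← Real.sin_add_int_mul_two_pi (Real.pi / 3) j]; congr 1; push_cast; ring
  · rw [← Real.sin_pi_div_three, ← Real.sin_neg, ← Real.sin_add_int_mul_two_pi (-(Real.pi / 3)) j]
    congr 1; push_cast; ring

lemma χ_eq_sin (m : ℤ) :
    (χ m : ℝ) * Real.sqrt 3 = 2 * Real.sin (m * (Real.pi / 2)) * Real.sin (m * (Real.pi / 3)) := by
  have h12 : 0 ≤ m % 12 ∧ m % 12 < 12 := ⟨by lia, by lia⟩
  have hm : m = 12 * (m / 12) + m % 12 := by lia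
  unfold χ
  generalize m % 12 = r at *
  generalize m / 12 = q at *
  obtain ⟨hr0, hr1⟩ := h12
  have two : ∀ j, m = 2 * j → Real.sin (m * (Real.pi / 2)) = 0 := by
    rintro j rfl; exact (sin_int_mul_pi_div_two j).1
  have four_add : ∀ j, m = 4 * j + 1 → Real.sin (m * (Real.pi / 2)) = 1 := by
    rintro j rfl; exact (sin_int_mul_pi_div_two j).2.1
  have four_sub : ∀ j, m = 4 * j - 1 → Real.sin (m * (Real.pi / 2)) = -1 := by
    rintro j rfl; exact (sin_int_mul_pi_div_two j).2.2
  have three : ∀ j, m = 3 * j → Real.sin (m * (Real.pi / 3)) = 0 := by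
    rintro j rfl; exact (sin_int_mul_pi_div_three j).1
  have six_add : ∀ j, m = 6 * j + 1 → Real.sin (m * (Real.pi / 3)) = Real.sqrt 3 / 2 := by
    rintro j rfl; exact (sin_int_mul_pi_div_three j).2.1
  have six_sub : ∀ j, m = 6 * j - 1 → Real.sin (m * (Real.pi / 3)) = -(Real.sqrt 3 / 2) := by
    rintro j rfl; exact (sin_int_mul_pi_div_three j).2.2
  interval_cases r
  · rw [two (6 * q) (by lia)]; simp
  · rw [four_add (3 * q) (by lia), six_add (2 * q) (by lia)]; norm_num; ring
  · rw [two (6 * q + 1) (by lia)]; simp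
  · rw [three (4 * q + 1) (by lia)]; simp
  · rw [two (6 * q + 2) (by lia)]; simp
  · rw [four_add (3 * q + 1) (by lia), six_sub (2 * q + 1) (by lia)]; norm_num; ring
  · rw [two (6 * q + 3) (by lia)]; simp
  · rw [four_sub (3 * q + 2) (by lia), six_add (2 * q + 1) (by lia)]; norm_num; ring
  · rw [two (6 * q + 4) (by lia)]; simp
  · rw [three (4 * q + 3) (by lia)]; simp
  · rw [two (6 * q + 5) (by lia)]; simp
  · rw [four_sub (3 * q + 3) (by lia), six_sub (2 * q + 2) (by lia)]; norm_num; ring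

/-- `χ` as a combination of additive characters. -/
lemma χ_eq_exp (m : ℤ) :
    (χ m : ℂ) * (2 * Real.sqrt 3) =
      cexp (2 * Real.pi * I * m * (1 / 12)) + cexp (2 * Real.pi * I * m * (-(1 / 12))) -
      (cexp (2 * Real.pi * I * m * (5 / 12)) + cexp (2 * Real.pi * I * m * (-(5 / 12)))) := by
  have key : (χ m : ℝ) * Real.sqrt 3 =
      Real.cos (Real.pi * m / 6) - Real.cos (5 * Real.pi * m / 6) := by
    rw [χ_eq_sin, Real.cos_sub_cos,
      show (Real.pi * (m : ℝ) / 6 + 5 * Real.pi * m / 6) / 2 = m * (Real.pi / 2) by ring,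
      show (Real.pi * (m : ℝ) / 6 - 5 * Real.pi * m / 6) / 2 = - (m * (Real.pi / 3)) by ring,
      Real.sin_neg]
    ring
  have := congrArg (fun x : ℝ => (x : ℂ)) key
  push_cast at this
  rw [mul_left_comm, this, Complex.cos, Complex.cos]
  ring_nf

lemma hasSum_etaTheta {z : ℂ} (hz : 0 < z.im) :
    HasSum (fun m : ℤ => (χ m : ℂ) * cexp (Real.pi * I * (m : ℂ) ^ 2 * z / 12)) (etaTheta z) ∧
    etaTheta z * Real.sqrt 3 = jacobiTheta₂ (1 / 12) (z / 12) - jacobiTheta₂ (5 / 12) (z / 12) := by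
  have hz' : 0 < (z / 12).im := by
    rw [show z / 12 = z * ((1 / 12 : ℝ) : ℂ) by push_cast; ring, Complex.im_mul_ofReal]; positivity
  have h3 : (Real.sqrt 3 : ℂ) ≠ 0 := by
    exact_mod_cast (Real.sqrt_pos.2 (by norm_num : (0 : ℝ) < 3)).ne'
  have key := (((hasSum_jacobiTheta₂_term (1 / 12) hz').add
    (hasSum_jacobiTheta₂_term (-(1 / 12)) hz')).sub ((hasSum_jacobiTheta₂_term (5 / 12) hz').add
    (hasSum_jacobiTheta₂_term (-(5 / 12)) hz'))).mul_left ((2 * Real.sqrt 3 : ℂ)⁻¹)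
  rw [jacobiTheta₂_neg_left, jacobiTheta₂_neg_left] at key
  have key' := key.congr_fun (g := fun m : ℤ => (χ m : ℂ) * cexp (Real.pi * I * (m : ℂ) ^ 2 * z / 12))
    fun m => by
      rw [← mul_right_inj' (mul_ne_zero two_ne_zero h3), mul_inv_cancel_left₀ (by simp [h3])]
      simp only [jacobiTheta₂_term, Complex.exp_add]
      rw [← mul_assoc, mul_comm (2 * (Real.sqrt 3 : ℂ)), χ_eq_exp]
      ring_nf
  have hval : etaTheta z = _ := key'.tsum_eq
  refine ⟨hval ▸ key', ?_⟩
  rw [hval]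
  field_simp
  ring

/-- The transformation of the theta series under `z ↦ -1/z`. -/
lemma norm_etaTheta_neg_inv {z : ℂ} (hz : 0 < z.im) :
    ‖etaTheta (-z)⁻¹‖ = ‖etaTheta z‖ * √‖z‖ := by
  have hz0 : z ≠ 0 := fun h0 => by simp [h0] at hz
  have hw : 0 < ((-z)⁻¹).im := by
    rw [Complex.inv_im]
    have := Complex.normSq_pos.2 (neg_ne_zero.2 hz0)
    simp only [Complex.neg_im, neg_neg]
    positivity
  have hw' : 0 < (-1 / (z / 12)).im := by
    rw [show -1 / (z / 12) = (-z)⁻¹ * ((12 : ℝ) : ℂ) by push_cast; field_simp, Complex.im_mul_ofReal]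
    positivity
  have hsum : ∀ a : ℤ, HasSum
      (fun n : ℤ => cexp (Real.pi * I * ((12 * n - a : ℤ) : ℂ) ^ 2 * (-z)⁻¹ / 12))
      (cexp (-Real.pi * I * (a / 12) ^ 2 / (z / 12)) *
        jacobiTheta₂ (a / 12 / (z / 12)) (-1 / (z / 12))) := fun a => by
    refine ((hasSum_jacobiTheta₂_term _ hw').mul_left _).congr_fun fun n => ?_
    rw [jacobiTheta₂_term, ← Complex.exp_add]
    congr 1
    push_cast
    field_simp
    ring
  have hw_eq := (hasSum_χ_mul (f := fun m => cexp (Real.pi * I * (m : ℂ) ^ 2 * (-z)⁻¹ / 12))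
    (fun m => by push_cast; rw [neg_sq]) (hsum 1) (hsum 5)).tsum_eq
  obtain ⟨-, hz_eq⟩ := hasSum_etaTheta hz
  rw [jacobiTheta₂_functional_equation, jacobiTheta₂_functional_equation (5 / 12),
    mul_assoc (1 / _), mul_assoc (1 / _), ← mul_sub] at hz_eq
  push_cast at hw_eq
  rw [etaTheta, hw_eq, ← mul_sub, norm_mul]
  have hn := congrArg norm hz_eq
  rw [norm_mul, norm_mul, norm_div, norm_one] at hn
  have hc : ‖(-I * (z / 12)) ^ (1 / 2 : ℂ)‖ = √‖z‖ / (2 * √3) := by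
    rw [show (1 / 2 : ℂ) = ((1 / 2 : ℝ) : ℂ) by push_cast; rfl, Complex.norm_cpow_real,
      ← Real.sqrt_eq_rpow]
    rw [norm_mul, norm_div]
    simp only [norm_neg, Complex.norm_I, one_mul, Complex.norm_ofNat]
    rw [Real.sqrt_div (norm_nonneg z), show (12 : ℝ) = 2 ^ 2 * 3 by norm_num,
      Real.sqrt_mul (by norm_num), Real.sqrt_sq (by norm_num)]
  rw [hc] at hn
  have h3 : 0 < √(3 : ℝ) := Real.sqrt_pos.2 (by norm_num)
  have hsz : 0 < √‖z‖ := Real.sqrt_pos.2 (norm_pos_iff.2 hz0)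
  have h3n : ‖((√(3 : ℝ) : ℝ) : ℂ)‖ = √3 := by simp
  rw [h3n] at hn
  simp only [Complex.norm_ofNat]
  generalize ‖cexp _ * _ - _‖ = w at hn ⊢
  field_simp at hn
  linarith

lemma norm_etaTheta_one_add (z : ℂ) : ‖etaTheta (1 + z)‖ = ‖etaTheta z‖ := by
  have : etaTheta (1 + z) = cexp (Real.pi * I / 12) * etaTheta z := by
    rw [etaTheta, etaTheta, ← tsum_mul_left]
    congr 1
    ext m
    by_cases hm : m % 12 = 1 ∨ m % 12 = 11 ∨ m % 12 = 5 ∨ m % 12 = 7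
    · obtain ⟨k, hk⟩ : ∃ k, m ^ 2 = 24 * k + 1 := by
        have h24 : m ^ 2 % 24 = 1 := by
          have : m % 24 = 1 ∨ m % 24 = 5 ∨ m % 24 = 7 ∨ m % 24 = 11 ∨ m % 24 = 13 ∨ m % 24 = 17 ∨
            m % 24 = 19 ∨ m % 24 = 23 := by lia
          rw [pow_two, Int.mul_emod]
          rcases this with h0 | h0 | h0 | h0 | h0 | h0 | h0 | h0 <;> rw [h0] <;> rfl
        exact ⟨m ^ 2 / 24, by lia⟩
      have hk' : (m : ℂ) ^ 2 = 24 * k + 1 := by exact_mod_cast hk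
      rw [mul_left_comm, ← Complex.exp_add]
      congr 1
      rw [← Complex.exp_periodic.int_mul k (Real.pi * I / 12 + _)]
      congr 1
      rw [hk']
      ring
    · have : χ m = 0 := by unfold χ; grind
      simp [this]
  rw [this, norm_mul, show (Real.pi * I / 12 : ℂ) = ((Real.pi / 12 : ℝ) : ℂ) * I by push_cast; ring,
    Complex.norm_exp_ofReal_mul_I, one_mul]

/-- The invariant height function of the theta series is invariant under the modular group. -/
lemma norm_etaTheta_smul (g : Matrix.SpecialLinearGroup (Fin 2) ℤ) (z : UpperHalfPlane) :
    ‖etaTheta (g • z : UpperHalfPlane)‖ * √√(g • z).im = ‖etaTheta z‖ * √√z.im := by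
  have hg : g ∈ Subgroup.closure {ModularGroup.S, ModularGroup.T} := by
    simp [SpecialLinearGroup.SL2Z_generators]
  induction hg using Subgroup.closure_induction generalizing z with
  | mem x hx =>
    rcases hx with rfl | rfl
    · have hz0 : 0 < ‖(z : ℂ)‖ := norm_pos_iff.2 z.ne_zero
      rw [UpperHalfPlane.modular_S_smul]
      change ‖etaTheta (-(z : ℂ))⁻¹‖ * √√((-(z : ℂ))⁻¹).im = _
      rw [norm_etaTheta_neg_inv z.im_pos, Complex.inv_im, Complex.neg_im, neg_neg,
        Complex.normSq_neg, Complex.normSq_eq_norm_sq, Real.sqrt_div (show 0 ≤ (z : ℂ).im from z.im_pos.le),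
        Real.sqrt_sq hz0.le, Real.sqrt_div (Real.sqrt_nonneg _)]
      have := Real.sqrt_pos.2 hz0
      field_simp
      rfl
    · rw [UpperHalfPlane.modular_T_smul]
      have h1 : (((1 : ℝ) +ᵥ z : UpperHalfPlane) : ℂ) = 1 + z := by simp
      rw [h1, norm_etaTheta_one_add, UpperHalfPlane.vadd_im]
  | one => simp
  | mul x y _ _ hx hy => rw [mul_smul, hx, hy]
  | inv x _ hx => rw [← hx, smul_inv_smul]

/-- Irrational numbers admit Dirichlet approximations with arbitrarily large denominators. -/
lemma exists_rat_large_den {x : ℝ} (hx : Irrational x) (N : ℕ) :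
    ∃ r : ℚ, N < r.den ∧ |x - r| ≤ 1 / (r.den : ℝ) ^ 2 := by
  obtain ⟨ε, hε, hε0⟩ := (((hx.eventually_forall_le_dist_cast_rat_of_den_le N).filter_mono
    nhdsWithin_le_nhds).and (self_mem_nhdsWithin (s := Set.Ioi (0 : ℝ)))).exists
  obtain ⟨n, hn⟩ := exists_nat_one_div_lt (show 0 < ε from hε0)
  obtain ⟨r, hr, hrn⟩ := Real.exists_rat_abs_sub_le_and_den_le x (Nat.succ_pos n)
  have hd : (1 : ℝ) ≤ r.den := by exact_mod_cast r.den_pos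
  have hrn' : (r.den : ℝ) ≤ n + 1 := by exact_mod_cast hrn
  refine ⟨r, ?_, hr.trans ?_⟩
  · by_contra! hle
    have h1 := hε r hle
    rw [Real.dist_eq] at h1
    have h2 : 1 / (((n.succ : ℕ) + 1 : ℝ) * r.den) ≤ 1 / ((n : ℝ) + 1) := by
      apply one_div_le_one_div_of_le (by positivity)
      push_cast
      nlinarith
    linarith
  · apply one_div_le_one_div_of_le (by positivity)
    push_cast
    nlinarith

/-- The theta series over `ℤ` is twice the one over `ℕ`. -/
lemma hasSum_nat_etaTheta {z : ℂ} (hz : 0 < z.im) :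
    HasSum (fun n : ℕ => (χ n : ℂ) * cexp (Real.pi * I * (n : ℂ) ^ 2 * z / 12))
      (etaTheta z / 2) := by
  have h0 := ((hasSum_etaTheta hz).1.nat_add_neg).mul_left (1 / 2)
  have hχ : χ 0 = 0 := rfl
  rw [hχ] at h0
  convert! h0 using 1
  · ext n
    rw [χ_neg]
    push_cast
    rw [neg_sq]
    ring
  · push_cast; ring

/-- The first term of the theta series dominates high in the upper half-plane. -/
lemma le_norm_etaTheta {z : ℂ} (hz : 1 / 2 ≤ z.im) (hz1 : z.im ≤ 1) :
    Real.exp (-Real.pi / 12) ≤ ‖etaTheta z‖ := by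
  have hz0 : 0 < z.im := by linarith
  set r : ℝ := Real.exp (-Real.pi * z.im / 12) with hr
  have hr0 : 0 < r := Real.exp_pos _
  have hpi := Real.pi_gt_three
  have hterm : ∀ n : ℕ, ‖cexp (Real.pi * I * (n : ℂ) ^ 2 * z / 12)‖ = r ^ (n ^ 2) := fun n => by
    rw [Complex.norm_exp, hr, ← Real.exp_nat_mul]
    congr 1
    rw [show (Real.pi * I * (n : ℂ) ^ 2 * z / 12) = ((Real.pi * n ^ 2 / 12 : ℝ) : ℂ) * (I * z) by
      push_cast; ring, Complex.re_ofReal_mul]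
    simp
    ring
  have hexp : ∀ k : ℕ, r ^ k ≤ 1 / (1 + k * (Real.pi * z.im / 12)) := fun k => by
    rw [hr, ← Real.exp_nat_mul, show (k : ℝ) * (-Real.pi * z.im / 12) = -(k * (Real.pi * z.im / 12))
      by ring, Real.exp_neg, ← one_div]
    apply one_div_le_one_div_of_le (by positivity)
    linarith [Real.add_one_le_exp (k * (Real.pi * z.im / 12))]
  have h10 : r ^ 10 ≤ 1 / 2 := (hexp 10).trans <| by
    apply one_div_le_one_div_of_le (by norm_num); push_cast; nlinarith
  have h24 : r ^ 24 ≤ 1 / 4 := (hexp 24).trans <| by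
    apply one_div_le_one_div_of_le (by norm_num); push_cast; nlinarith
  have hr1 : r < 1 := by
    rw [hr, Real.exp_lt_one_iff]; nlinarith
  have hs := hasSum_nat_etaTheta hz0
  have hs1 := (hasSum_nat_add_iff' 5).2 hs
  have hχ0 : χ 0 = 0 := rfl
  have hχ1 : χ 1 = 1 := rfl
  have hχ2 : χ 2 = 0 := rfl
  have hχ3 : χ 3 = 0 := rfl
  have hχ4 : χ 4 = 0 := rfl
  simp only [Finset.sum_range_succ, Finset.sum_range_zero] at hs1
  norm_num [hχ0, hχ1, hχ2, hχ3, hχ4] at hs1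
  have hgeo : HasSum (fun n : ℕ => r ^ 25 * (r ^ 10) ^ n) (r ^ 25 * (1 - r ^ 10)⁻¹) :=
    (hasSum_geometric_of_lt_one (by positivity) (by linarith)).mul_left _
  have hbound := hs1.norm_le_of_bounded hgeo fun n => by
    rw [norm_mul]
    have h1 : ‖(χ ((n : ℤ) + 5) : ℂ)‖ ≤ 1 := by
      unfold χ; split_ifs <;> simp
    have h2 := hterm (n + 5)
    push_cast at h2
    rw [h2, ← pow_mul, ← pow_add]
    refine (mul_le_of_le_one_left (by positivity) h1).trans ?_
    exact pow_le_pow_of_le_one hr0.le hr1.le (by nlinarith)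
  have h1 := hterm 1
  norm_num at h1
  have h2 : ‖cexp (Real.pi * I * z / 12)‖ ≤ ‖etaTheta z / 2‖ +
      ‖etaTheta z / 2 - cexp (Real.pi * I * z / 12)‖ := by
    have := norm_sub_le (etaTheta z / 2) (etaTheta z / 2 - cexp (Real.pi * I * z / 12))
    simpa using this
  have h3 : r ^ 25 * (1 - r ^ 10)⁻¹ ≤ r / 2 := by
    rw [← div_eq_mul_inv, div_le_iff₀ (by linarith)]
    nlinarith [pow_pos hr0 10, pow_pos hr0 24]
  have h4 : Real.exp (-Real.pi / 12) ≤ r := by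
    rw [hr]; apply Real.exp_le_exp.2; nlinarith
  rw [norm_div, Complex.norm_ofNat] at h2
  rw [h1] at h2
  linarith

/-- On the vertical line above an irrational number there are points of arbitrarily small height
at which the theta series is as large as its weight allows. -/
lemma exists_le_norm_etaTheta {x : ℝ} (hx : Irrational x) (N : ℕ) :
    ∃ q : ℕ, N < q ∧ Real.exp (-Real.pi / 12) * √√(1 / 2) ≤
      ‖etaTheta (x + (1 / (q : ℝ) ^ 2 : ℝ) * I)‖ * √√(1 / (q : ℝ) ^ 2) := by
  obtain ⟨r, hN, hr⟩ := exists_rat_large_den hx N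
  refine ⟨r.den, hN, ?_⟩
  have hd : (0 : ℝ) < r.den := by exact_mod_cast r.den_pos
  set y : ℝ := 1 / (r.den : ℝ) ^ 2 with hy
  have hy0 : 0 < y := by positivity
  obtain ⟨g, hg0, hg1⟩ := (Rat.isCoprime_num_den r).symm.neg_right.exists_SL2_row 1
  let z : UpperHalfPlane := ⟨x + y * I, by simpa using hy0⟩
  have him : z.im = y := by simp [z, ← UpperHalfPlane.coe_im]
  have hden : Complex.normSq ((r.den : ℂ) * (z : ℂ) - r.num) =
      (r.den : ℝ) ^ 2 * ((x - r) ^ 2 + y ^ 2) := by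
    have hr' : (r : ℝ) = r.num / r.den := by exact_mod_cast (Rat.num_div_den r).symm
    rw [Complex.normSq_apply, hr']
    simp [z]
    field_simp
  have hgim : (g • z).im = y / ((r.den : ℝ) ^ 2 * ((x - r) ^ 2 + y ^ 2)) := by
    rw [ModularGroup.im_smul_eq_div_normSq, ModularGroup.denom_apply, hg0, hg1, him, ← hden]
    push_cast
    rw [sub_eq_add_neg]
  have hsq : (x - r) ^ 2 ≤ y ^ 2 := sq_le_sq' (by linarith [neg_abs_le (x - r)]) (by
    linarith [le_abs_self (x - r)])
  have hdy : (r.den : ℝ) ^ 2 * y = 1 := by rw [hy]; field_simp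
  have hlow : 1 / 2 ≤ (g • z).im := by
    rw [hgim, le_div_iff₀ (by positivity)]
    nlinarith
  have hup : (g • z).im ≤ 1 := by
    rw [hgim, div_le_one (by positivity)]
    nlinarith [sq_nonneg (x - r), mul_nonneg (sq_nonneg (r.den : ℝ)) (sq_nonneg (x - r))]
  have hinv := norm_etaTheta_smul g z
  rw [him] at hinv
  change _ ≤ ‖etaTheta z‖ * _
  rw [← hinv]
  exact mul_le_mul (le_norm_etaTheta hlow hup) (Real.sqrt_le_sqrt (Real.sqrt_le_sqrt hlow))
    (Real.sqrt_nonneg _) (norm_nonneg _)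

/-- The analysing kernel `(2π + 2πis)⁻²`. -/
noncomputable def cauchyKernel (s : ℝ) : ℂ := 1 / (2 * Real.pi + 2 * Real.pi * I * s) ^ 2

lemma integral_mul_exp_neg_mul_Ioi {c : ℂ} (hc : 0 < c.re) :
    ∫ t : ℝ in Set.Ioi 0, (t : ℂ) * cexp (-c * t) = 1 / c ^ 2 := by
  have hc0 : c ≠ 0 := fun h0 => by simp [h0] at hc
  have hint : MeasureTheory.IntegrableOn (fun t : ℝ => (t : ℂ) * cexp (-c * t)) (Set.Ioi 0) := by
    refine MeasureTheory.Integrable.mono' (integrableOn_rpow_mul_exp_neg_mul_rpow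
      (s := 1) (p := 1) (by norm_num) one_pos hc) (by fun_prop) ?_
    refine (MeasureTheory.ae_restrict_iff' measurableSet_Ioi).2 (Eventually.of_forall fun t ht => ?_)
    have ht' : 0 < t := ht
    simp [Complex.norm_exp, abs_of_pos ht']
  have hderiv : ∀ t : ℝ, HasDerivAt
      (fun t : ℝ => -((t : ℂ) / c + 1 / c ^ 2) * cexp (-c * t)) ((t : ℂ) * cexp (-c * t)) t := by
    intro t
    have h1 := (((hasDerivAt_id (t : ℂ)).div_const c).add_const (1 / c ^ 2)).neg
    have h2 := ((hasDerivAt_id (t : ℂ)).const_mul (-c)).cexp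
    convert! (h1.mul h2).comp_ofReal using 1
    simp only [id, Pi.neg_apply]
    field_simp
    ring
  have htend : Tendsto (fun t : ℝ => -((t : ℂ) / c + 1 / c ^ 2) * cexp (-c * t)) atTop (𝓝 0) := by
    have hpow : ∀ k : ℕ, Tendsto (fun t : ℝ => (t : ℂ) ^ k * cexp (-c * t)) atTop (𝓝 0) := fun k => by
      rw [tendsto_zero_iff_norm_tendsto_zero]
      refine (tendsto_rpow_mul_exp_neg_mul_atTop_nhds_zero k c.re hc).congr' ?_
      filter_upwards [eventually_gt_atTop 0] with t ht
      simp [Complex.norm_exp, abs_of_pos ht]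
    have := ((hpow 1).const_mul (-(1 / c))).add ((hpow 0).const_mul (-(1 / c ^ 2)))
    rw [mul_zero, mul_zero, add_zero] at this
    refine this.congr fun t => ?_
    ring
  have := MeasureTheory.integral_Ioi_of_hasDerivAt_of_tendsto' (fun t _ => hderiv t) hint htend
  rw [this]
  simp

lemma norm_cauchyKernel_le (s : ℝ) : ‖cauchyKernel s‖ ≤ (1 + |s|) ^ (-2 : ℝ) := by
  have hpi := Real.pi_gt_three
  have hn : ‖(2 * Real.pi + 2 * Real.pi * I * s : ℂ)‖ ^ 2 = (2 * Real.pi) ^ 2 * (1 + s ^ 2) := by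
    rw [← Complex.normSq_eq_norm_sq, Complex.normSq_apply]
    simp
    ring
  rw [cauchyKernel, norm_div, norm_one, norm_pow, hn, Real.rpow_neg (by positivity), ← one_div]
  apply one_div_le_one_div_of_le (by positivity)
  norm_cast
  have := sq_abs s
  have h4 : 2 ≤ (2 * Real.pi) ^ 2 := by nlinarith
  have := mul_le_mul_of_nonneg_right h4 (by positivity : 0 ≤ 1 + s ^ 2)
  nlinarith [sq_nonneg (1 - |s|), sq_nonneg s]

lemma continuous_cauchyKernel : Continuous cauchyKernel := by
  unfold cauchyKernel
  refine continuous_const.div (by fun_prop) fun s => pow_ne_zero 2 fun h0 => ?_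
  have := congrArg Complex.re h0
  simp [Real.pi_ne_zero] at this

lemma integrable_abs_rpow_mul_cauchyKernel {β : ℝ} (hβ0 : 0 ≤ β) (hβ1 : β < 1) :
    MeasureTheory.Integrable (fun s : ℝ => |s| ^ β * ‖cauchyKernel s‖) := by
  refine MeasureTheory.Integrable.mono' (integrable_one_add_norm (E := ℝ) (r := 2 - β)
    (by simp; linarith)) ?_ (Eventually.of_forall fun s => ?_)
  · exact ((continuous_abs.rpow_const fun _ => Or.inr hβ0).mul
      continuous_cauchyKernel.norm).aestronglyMeasurable
  · rw [Real.norm_of_nonneg (by positivity), Real.norm_eq_abs,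
      show -(2 - β) = β + (-2) by ring, Real.rpow_add (by positivity)]
    gcongr
    · linarith
    · exact norm_cauchyKernel_le s

lemma integrable_cauchyKernel : MeasureTheory.Integrable cauchyKernel := by
  rw [← MeasureTheory.integrable_norm_iff continuous_cauchyKernel.aestronglyMeasurable]
  simpa using integrable_abs_rpow_mul_cauchyKernel (β := 0) le_rfl one_pos

/-- The kernel has Fourier transform supported on a half-line. -/
lemma integral_exp_mul_cauchyKernel (ν : ℝ) :
    ∫ s : ℝ, e (ν * s) * cauchyKernel s = (max ν 0 * Real.exp (-(2 * Real.pi * ν)) : ℝ) := by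
  set g : ℝ → ℂ := fun v => ((max v 0 * Real.exp (-(2 * Real.pi * v)) : ℝ) : ℂ) with hg
  have hgc : Continuous g := by fun_prop
  have hgind : ∀ φ : ℝ → ℂ, (fun v => φ v * g v) =
      (Set.Ioi 0).indicator fun v : ℝ => φ v * ((v : ℂ) * cexp (-(2 * Real.pi) * v)) := fun φ => by
    ext v
    by_cases hv : 0 < v
    · rw [Set.indicator_of_mem (show v ∈ Set.Ioi 0 from hv)]
      simp [hg, max_eq_left hv.le]
    · rw [Set.indicator_of_notMem (show v ∉ Set.Ioi 0 from hv)]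
      simp [hg, max_eq_right (not_lt.1 hv)]
  have hgi : MeasureTheory.Integrable g := by
    have h1 := hgind fun _ => 1
    simp only [one_mul] at h1
    change MeasureTheory.Integrable fun v => g v
    rw [h1, MeasureTheory.integrable_indicator_iff measurableSet_Ioi]
    refine MeasureTheory.Integrable.mono' (integrableOn_rpow_mul_exp_neg_mul_rpow
      (s := 1) (p := 1) (by norm_num) one_pos Real.two_pi_pos) (by fun_prop) ?_
    refine (MeasureTheory.ae_restrict_iff' measurableSet_Ioi).2 (Eventually.of_forall fun t ht => ?_)
    have ht' : 0 < t := ht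
    simp [Complex.norm_exp, abs_of_pos ht']
  have hF : FourierTransform.fourier g = cauchyKernel := by
    ext w
    rw [Real.fourier_real_eq_integral_exp_smul]
    simp only [smul_eq_mul]
    rw [hgind fun v => cexp (↑(-2 * Real.pi * v * w) * I),
      MeasureTheory.integral_indicator measurableSet_Ioi, cauchyKernel,
      ← integral_mul_exp_neg_mul_Ioi (by simp [Real.pi_pos])]
    congr 1
    ext v
    rw [mul_left_comm, ← Complex.exp_add]
    congr 2
    push_cast
    ring
  have hinv := congrFun (hgc.fourierInv_fourier_eq hgi (hF ▸ integrable_cauchyKernel)) ν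
  rw [hF, Real.fourierInv_eq'] at hinv
  refine Eq.trans ?_ hinv
  congr 1
  ext s
  rw [e, smul_eq_mul]
  congr 2
  simp
  ring

lemma norm_e (t : ℝ) : ‖e t‖ = 1 := by
  rw [e, show (2 * Real.pi * I * t : ℂ) = ((2 * Real.pi * t : ℝ) : ℂ) * I by push_cast; ring,
    Complex.norm_exp_ofReal_mul_I]

lemma e_add (s t : ℝ) : e (s + t) = e s * e t := by
  rw [e, e, e, ← Complex.exp_add]; push_cast; ring_nf

lemma conj_e (t : ℝ) : (starRingEnd ℂ) (e t) = e (-t) := by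
  rw [e, e, ← Complex.exp_conj]; simp [Complex.conj_ofNat]

lemma norm_χ_div_sq_le (n : ℕ) : ‖(χ n : ℂ) / (n : ℂ) ^ 2‖ ≤ 1 / (n : ℝ) ^ 2 := by
  rw [norm_div, norm_pow, Complex.norm_natCast]
  gcongr
  unfold χ; split_ifs <;> simp

lemma summable_h (x : ℝ) :
    Summable fun n : ℕ => (χ (n : ℤ) : ℂ) / (n : ℂ) ^ 2 * e ((n : ℝ) ^ 2 * x / 24) := by
  refine (Real.summable_one_div_nat_pow.2 one_lt_two).of_norm_bounded fun n => ?_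
  rw [norm_mul, norm_e, mul_one]
  exact norm_χ_div_sq_le n

lemma norm_h_le (x : ℝ) : ‖h x‖ ≤ ∑' n : ℕ, 1 / (n : ℝ) ^ 2 := by
  refine tsum_of_norm_bounded (Real.summable_one_div_nat_pow.2 one_lt_two).hasSum fun n => ?_
  rw [norm_mul, norm_e, mul_one]
  exact norm_χ_div_sq_le n

/-- The wavelet transform of a real coordinate of `h` is the theta series. -/
lemma integral_re_mul_h (u : ℂ) (x : ℝ) {a : ℝ} (ha : 0 < a) :
    ∫ s : ℝ, ((u * h (x + a * s)).re : ℂ) * cauchyKernel s =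
      u * a / 96 * etaTheta (x + a * I) := by
  set F : ℕ → ℝ → ℂ := fun n s => (χ n : ℂ) / (n : ℂ) ^ 2 / 2 *
    (u * e ((n : ℝ) ^ 2 * x / 24) * (e ((n : ℝ) ^ 2 * a / 24 * s) * cauchyKernel s) +
      (starRingEnd ℂ) u * e (-((n : ℝ) ^ 2 * x / 24)) *
        (e (-((n : ℝ) ^ 2 * a / 24) * s) * cauchyKernel s)) with hF
  have hint : ∀ ν : ℝ, MeasureTheory.Integrable fun s : ℝ => e (ν * s) * cauchyKernel s := fun ν =>
    integrable_cauchyKernel.bdd_mul (c := 1)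
      (by unfold e; exact Continuous.aestronglyMeasurable (by fun_prop))
      (Eventually.of_forall fun s => (norm_e _).le)
  have hFint : ∀ n, MeasureTheory.Integrable (F n) := fun n =>
    (((hint _).const_mul _).add ((hint _).const_mul _)).const_mul _
  have hFnorm : ∀ n s, ‖F n s‖ ≤ 1 / (n : ℝ) ^ 2 * (‖u‖ * ‖cauchyKernel s‖) := fun n s => by
    have h1 : ‖u * e ((n : ℝ) ^ 2 * x / 24) * (e ((n : ℝ) ^ 2 * a / 24 * s) * cauchyKernel s) +
      (starRingEnd ℂ) u * e (-((n : ℝ) ^ 2 * x / 24)) *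
        (e (-((n : ℝ) ^ 2 * a / 24) * s) * cauchyKernel s)‖ ≤ 2 * (‖u‖ * ‖cauchyKernel s‖) := by
      refine (norm_add_le _ _).trans (le_of_eq ?_)
      simp only [norm_mul, norm_e, RCLike.norm_conj]
      ring
    rw [hF]
    simp only
    rw [norm_mul, norm_div, Complex.norm_ofNat]
    calc _ ≤ 1 / (n : ℝ) ^ 2 / 2 * (2 * (‖u‖ * ‖cauchyKernel s‖)) := by
          gcongr; exact norm_χ_div_sq_le n
      _ = _ := by ring
  have hsummable : Summable fun n => ∫ s, ‖F n s‖ := by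
    refine Summable.of_nonneg_of_le (fun n => MeasureTheory.integral_nonneg fun s => norm_nonneg _)
      (fun n => ?_) ((Real.summable_one_div_nat_pow.2 one_lt_two).mul_right
        (∫ s, ‖u‖ * ‖cauchyKernel s‖))
    rw [← MeasureTheory.integral_const_mul]
    exact MeasureTheory.integral_mono (hFint n).norm
      ((integrable_cauchyKernel.norm.const_mul _).const_mul _) (hFnorm n)
  have hsum := MeasureTheory.hasSum_integral_of_summable_integral_norm hFint hsummable
  have htsum : ∀ s, ∑' n, F n s = ((u * h (x + a * s)).re : ℂ) * cauchyKernel s := fun s => by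
    have h1 := (summable_h (x + a * s)).hasSum.mul_left u
    have h2 := ((h1.add (Complex.hasSum_conj'.2 h1)).mul_right (1 / 2)).mul_right (cauchyKernel s)
    rw [Complex.re_eq_add_conj, div_eq_mul_one_div]
    refine (h2.congr_fun fun n => ?_).tsum_eq
    have e1 : e ((n : ℝ) ^ 2 * (x + a * s) / 24) =
        e ((n : ℝ) ^ 2 * x / 24) * e ((n : ℝ) ^ 2 * a / 24 * s) := by
      rw [← e_add]; congr 1; ring
    simp only [hF, map_mul, map_div₀, map_pow, map_natCast, map_intCast, conj_e, e1, neg_mul]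
    ring
  simp_rw [htsum] at hsum
  have hz : 0 < ((x : ℂ) + a * I).im := by simpa using ha
  refine hsum.unique ?_
  have hθ := (hasSum_nat_etaTheta hz).mul_left (u * a / 48)
  convert! hθ using 1
  · ext n
    rw [hF]
    simp only
    rw [MeasureTheory.integral_const_mul, MeasureTheory.integral_add ((hint _).const_mul _)
      ((hint _).const_mul _), MeasureTheory.integral_const_mul, MeasureTheory.integral_const_mul,
      integral_exp_mul_cauchyKernel, integral_exp_mul_cauchyKernel,
      max_eq_left (by positivity : (0 : ℝ) ≤ (n : ℝ) ^ 2 * a / 24),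
      max_eq_right (neg_nonpos.2 (by positivity : (0 : ℝ) ≤ (n : ℝ) ^ 2 * a / 24))]
    rcases eq_or_ne n 0 with rfl | hn
    · have hχ : χ 0 = 0 := rfl
      simp [hχ]
    · have hn' : (n : ℂ) ≠ 0 := by exact_mod_cast hn
      have hexp : cexp (Real.pi * I * (n : ℂ) ^ 2 * (x + a * I) / 12) =
          e ((n : ℝ) ^ 2 * x / 24) * Real.exp (-(2 * Real.pi * ((n : ℝ) ^ 2 * a / 24))) := by
        rw [e, Complex.ofReal_exp, ← Complex.exp_add]
        congr 1
        push_cast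
        linear_combination (Real.pi * (n : ℂ) ^ 2 * a / 12) * Complex.I_mul_I
      rw [hexp]
      push_cast
      field_simp
      ring
  · ring

/-- A Hölder condition on a real coordinate of `h` bounds the theta series. -/
lemma norm_etaTheta_le_of_holder {u : ℂ} {x β C : ℝ} (hβ0 : 0 ≤ β) (hβ1 : β < 1)
    (hC : ∀ t, |(u * h (x + t)).re - (u * h x).re| ≤ C * |t| ^ β) {a : ℝ} (ha : 0 < a) :
    ‖u‖ * a / 96 * ‖etaTheta (x + a * I)‖ ≤
      C * a ^ β * ∫ s : ℝ, |s| ^ β * ‖cauchyKernel s‖ := by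
  have hzero : ∫ s : ℝ, cauchyKernel s = 0 := by
    have := integral_exp_mul_cauchyKernel 0
    simpa [e] using this
  have hmain := integral_re_mul_h u x ha
  have hcont : Continuous h := by
    refine continuous_tsum (fun n => ?_) (Real.summable_one_div_nat_pow.2 one_lt_two) fun n x => ?_
    · unfold e; fun_prop
    · rw [norm_mul, norm_e, mul_one]
      exact norm_χ_div_sq_le n
  have hint : MeasureTheory.Integrable
      fun s : ℝ => ((u * h (x + a * s)).re : ℂ) * cauchyKernel s := by
    refine integrable_cauchyKernel.bdd_mul (c := ‖u‖ * ∑' n : ℕ, 1 / (n : ℝ) ^ 2)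
      (Continuous.aestronglyMeasurable ?_) (Eventually.of_forall fun s => ?_)
    · exact Complex.continuous_ofReal.comp (Complex.continuous_re.comp
        (continuous_const.mul (hcont.comp (by fun_prop))))
    · rw [Complex.norm_real]
      refine (Complex.abs_re_le_norm _).trans ?_
      rw [norm_mul]
      gcongr
      exact norm_h_le _
  have hdiff : ∫ s : ℝ, (((u * h (x + a * s)).re - (u * h x).re : ℝ) : ℂ) * cauchyKernel s =
      u * a / 96 * etaTheta (x + a * I) := by
    rw [← hmain]
    simp_rw [Complex.ofReal_sub, sub_mul]
    rw [MeasureTheory.integral_sub hint (integrable_cauchyKernel.const_mul _),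
      MeasureTheory.integral_const_mul, hzero, mul_zero, sub_zero]
  have hnorm : ‖u * a / 96 * etaTheta (x + a * I)‖ = ‖u‖ * a / 96 * ‖etaTheta (x + a * I)‖ := by
    simp [abs_of_pos ha]
  rw [← hnorm, ← hdiff, ← MeasureTheory.integral_const_mul]
  refine MeasureTheory.norm_integral_le_of_norm_le
    ((integrable_abs_rpow_mul_cauchyKernel hβ0 hβ1).const_mul _) (Eventually.of_forall fun s => ?_)
  rw [norm_mul, Complex.norm_real, Real.norm_eq_abs, ← mul_assoc]
  gcongr
  refine (hC (a * s)).trans_eq ?_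
  rw [abs_mul, abs_of_pos ha, Real.mul_rpow ha.le (abs_nonneg s), mul_assoc]

/-- No real coordinate of `h` is Hölder continuous of index above `3/4` at an irrational point. -/
lemma not_holder_of_irrational {u : ℂ} (hu : u ≠ 0) {x β C : ℝ} (hx : Irrational x)
    (hβ0 : 3 / 4 < β) (hβ1 : β < 1) :
    ¬ ∀ t, |(u * h (x + t)).re - (u * h x).re| ≤ C * |t| ^ β := by
  intro hC
  set J := ∫ s : ℝ, |s| ^ β * ‖cauchyKernel s‖
  set κ := Real.exp (-Real.pi / 12) * √√(1 / 2)
  have hκ : 0 < κ := by positivity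
  have hu' : 0 < ‖u‖ := norm_pos_iff.2 hu
  have htend : Tendsto (fun n : ℕ => C * J * (1 / (n : ℝ) ^ 2) ^ (β - 3 / 4)) atTop (𝓝 0) := by
    have h1 : Tendsto (fun n : ℕ => 1 / (n : ℝ) ^ 2) atTop (𝓝 0) :=
      tendsto_const_nhds.div_atTop
        ((tendsto_pow_atTop two_ne_zero).comp tendsto_natCast_atTop_atTop)
    have h2 := (h1.rpow_const (p := β - 3 / 4) (Or.inr (by linarith))).const_mul (C * J)
    rwa [Real.zero_rpow (by linarith), mul_zero] at h2
  obtain ⟨N, hN⟩ := eventually_atTop.1 (htend.eventually_lt_const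
    (show 0 < ‖u‖ / 96 * κ by positivity))
  obtain ⟨q, hNq, hq⟩ := exists_le_norm_etaTheta hx N
  have hlt := hN q hNq.le
  have hq0 : (0 : ℝ) < q := by exact_mod_cast (Nat.zero_le N).trans_lt hNq
  set a : ℝ := 1 / (q : ℝ) ^ 2
  have ha : 0 < a := by positivity
  have hle := norm_etaTheta_le_of_holder (by linarith) hβ1 hC ha
  have hsq : √√a = a ^ (1 / 4 : ℝ) := by
    rw [Real.sqrt_eq_rpow, Real.sqrt_eq_rpow, ← Real.rpow_mul ha.le]; norm_num
  have hpow : a ^ (β - 3 / 4) * a = a ^ β * √√a := by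
    rw [hsq, ← Real.rpow_add_one ha.ne', ← Real.rpow_add ha]
    congr 1; ring
  have h1 : ‖u‖ / 96 * κ * a ≤ C * J * a ^ (β - 3 / 4) * a := by
    calc ‖u‖ / 96 * κ * a ≤ ‖u‖ / 96 * (‖etaTheta (x + a * I)‖ * √√a) * a := by gcongr
      _ = ‖u‖ * a / 96 * ‖etaTheta (x + a * I)‖ * √√a := by ring
      _ ≤ C * a ^ β * J * √√a := by gcongr
      _ = C * J * (a ^ β * √√a) := by ring
      _ = _ := by rw [← hpow]; ring
  exact absurd (le_of_mul_le_mul_right h1 ha) (not_le.2 hlt)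

lemma limsup_re_mul_h_eq_top {u : ℂ} (hu : u ≠ 0) {x₀ α : ℝ} (hx₀ : Irrational x₀)
    (hα : 3 / 4 < α) :
    Filter.limsup
        (fun x : ℝ => ((|x - x₀| ^ (-α) * |(u * h x).re - (u * h x₀).re| : ℝ) : EReal))
        (𝓝[≠] x₀) = ⊤ := by
  by_contra hne
  obtain ⟨M, hM, -⟩ := EReal.lt_iff_exists_real_btwn.1 (lt_top_iff_ne_top.2 hne)
  have hev := eventually_lt_of_limsup_lt hM
  rw [eventually_nhdsWithin_iff, Metric.eventually_nhds_iff] at hev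
  obtain ⟨δ', hδ', hev⟩ := hev
  obtain ⟨β, hβ0, hβ⟩ := exists_between (lt_min hα (by norm_num : (3 / 4 : ℝ) < 1))
  obtain ⟨hβα, hβ1⟩ := lt_min_iff.1 hβ
  set δ := min δ' 1
  have hδ : 0 < δ := lt_min hδ' one_pos
  set B := ‖u‖ * ∑' n : ℕ, 1 / (n : ℝ) ^ 2
  have hB : ∀ x, |(u * h x).re| ≤ B := fun x => (Complex.abs_re_le_norm _).trans <| by
    rw [norm_mul]
    exact mul_le_mul_of_nonneg_left (norm_h_le x) (norm_nonneg u)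
  have hB0 : 0 ≤ B := (abs_nonneg _).trans (hB 0)
  have hδβ : 0 < δ ^ β := Real.rpow_pos_of_pos hδ β
  refine not_holder_of_irrational (C := max |M| (2 * B / δ ^ β)) hu hx₀ hβ0 hβ1 fun t => ?_
  rcases eq_or_ne t 0 with rfl | ht
  · simp; positivity
  have ht0 : 0 < |t| := abs_pos.2 ht
  rcases lt_or_ge |t| δ with htδ | htδ
  · have h1 := hev (y := x₀ + t) (by simpa using htδ.trans_le (min_le_left _ _)) (by simpa using ht)
    rw [add_sub_cancel_left, EReal.coe_lt_coe_iff, Real.rpow_neg ht0.le, inv_mul_lt_iff₀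
      (Real.rpow_pos_of_pos ht0 α)] at h1
    have h2 : |t| ^ α ≤ |t| ^ β :=
      Real.rpow_le_rpow_of_exponent_ge ht0 (htδ.le.trans (min_le_right _ _)) hβα.le
    calc _ ≤ |t| ^ α * M := h1.le
      _ ≤ |t| ^ α * max |M| (2 * B / δ ^ β) := by
          gcongr
          exact (le_abs_self M).trans (le_max_left _ _)
      _ ≤ |t| ^ β * max |M| (2 * B / δ ^ β) := by
          gcongr
      _ = _ := mul_comm _ _
  · have h1 : |(u * h (x₀ + t)).re - (u * h x₀).re| ≤ 2 * B := by
      refine (abs_sub _ _).trans ?_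
      linarith [hB (x₀ + t), hB x₀]
    calc _ ≤ 2 * B := h1
      _ = 2 * B / δ ^ β * δ ^ β := by field_simp
      _ ≤ max |M| (2 * B / δ ^ β) * |t| ^ β := by
          gcongr
          exact le_max_right _ _

/-- At every irrational point, the real and imaginary parts of `h` violate the
pointwise Hölder condition of any index `α > 3/4`. -/
theorem stmt_14 (x₀ : ℝ) (hx₀ : Irrational x₀) (α : ℝ) (hα : 3/4 < α) :
    Filter.limsup
        (fun x : ℝ => ((|x - x₀| ^ (-α) * |(h x).re - (h x₀).re| : ℝ) : EReal))
        (𝓝[≠] x₀) = ⊤ ∧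
    Filter.limsup
        (fun x : ℝ => ((|x - x₀| ^ (-α) * |(h x).im - (h x₀).im| : ℝ) : EReal))
        (𝓝[≠] x₀) = ⊤ := by
  constructor
  · simpa using limsup_re_mul_h_eq_top one_ne_zero hx₀ hα
  · simpa using limsup_re_mul_h_eq_top (neg_ne_zero.2 I_ne_zero) hx₀ hα
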